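/- Let V be a nonempty finite type with distinguished element eos, M ≥ 0, and a : List V → V → ℝ with |a s v| ≤ M for all s, v; define the sequence model p by p s v = exp(a s v) / ∑_{w ∈ V} exp(a s w). Let q be any sequence model on V satisfying q s eos ≥ p s eos for every prefix s : List V. Then for every t ∈ ℕ, NT_q(t) ≤ (1 − exp(−2M)/|V|)^t, and NT_q(t) → 0 as t → ∞; that is, any decoding algorithm whose induced per-step eos probability dominates the model's eos probability is consistent with respect to the model. -/

import Mathlib

open Finset Filter

/-- Non-termination mass of a sequence model at horizon `t`. -/
noncomputable def NT {V : Type*} [Fintype V] [DecidableEq V]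
    (p : List V → V → ℝ) (eos : V) (t : ℕ) : ℝ :=
  ∑ y ∈ Finset.univ.filter (fun y : Fin t → V => ∀ i, y i ≠ eos),
    ∏ i : Fin t, p ((List.ofFn y).take i) (y i)

theorem NT_succ {V : Type*} [Fintype V] [DecidableEq V] (q : List V → V → ℝ) (eos : V) (t : ℕ) :
    NT q eos (t + 1) =
      ∑ v ∈ Finset.univ.erase eos, q [] v * NT (fun s => q (v :: s)) eos t := by
  have h : Finset.univ.erase eos = Finset.univ.filter (fun v : V => v ≠ eos) := by
    ext v; simp
  unfold NT
  rw [h, Finset.sum_filter, Finset.sum_filter, ← (Fin.consEquiv fun _ => V).sum_comp,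
    Fintype.sum_prod_type]
  refine Finset.sum_congr rfl fun v _ => ?_
  by_cases hv : v = eos
  · simp [Fin.consEquiv, Fin.forall_fin_succ, hv]
  · simp [Fin.consEquiv, Fin.forall_fin_succ, hv, Finset.mul_sum, Finset.sum_filter,
      Fin.prod_univ_succ]

theorem NT_nonneg {V : Type*} [Fintype V] [DecidableEq V] {q : List V → V → ℝ}
    (hq : ∀ s v, 0 ≤ q s v) (eos : V) (t : ℕ) : 0 ≤ NT q eos t :=
  Finset.sum_nonneg fun _ _ => Finset.prod_nonneg fun _ _ => hq _ _

theorem NT_le_pow {V : Type*} [Fintype V] [DecidableEq V] {eos : V} {r : ℝ} (hr : 0 ≤ r)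
    {q : List V → V → ℝ} (hq : ∀ s v, 0 ≤ q s v)
    (hsum : ∀ s, ∑ v ∈ Finset.univ.erase eos, q s v ≤ r) (t : ℕ) : NT q eos t ≤ r ^ t := by
  induction t generalizing q with
  | zero => simp [NT]
  | succ t ih =>
    rw [NT_succ, pow_succ']
    calc ∑ v ∈ Finset.univ.erase eos, q [] v * NT (fun s => q (v :: s)) eos t
        ≤ ∑ v ∈ Finset.univ.erase eos, q [] v * r ^ t := by
          gcongr with v
          · exact hq _ _
          · exact ih (fun s => hq (v :: s)) fun s => hsum (v :: s)
      _ = (∑ v ∈ Finset.univ.erase eos, q [] v) * r ^ t := (Finset.sum_mul ..).symm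
      _ ≤ r * r ^ t := by gcongr; exact hsum []

theorem exp_neg_div_card_le_softmax {V : Type*} [Fintype V] [Nonempty V] {M : ℝ} {f : V → ℝ}
    (hf : ∀ v, |f v| ≤ M) (v : V) :
    Real.exp (-(2 * M)) / (Fintype.card V : ℝ) ≤ Real.exp (f v) / ∑ w, Real.exp (f w) := by
  have hsum : ∑ w, Real.exp (f w) ≤ Fintype.card V * Real.exp M := by
    simpa using Finset.sum_le_card_nsmul Finset.univ (fun w => Real.exp (f w)) (Real.exp M)
      fun w _ => Real.exp_le_exp.2 (abs_le.1 (hf w)).2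
  have hpos : 0 < ∑ w, Real.exp (f w) :=
    Finset.sum_pos (fun w _ => Real.exp_pos _) Finset.univ_nonempty
  have hcard : (0 : ℝ) < Fintype.card V := Nat.cast_pos.2 Fintype.card_pos
  rw [div_le_div_iff₀ hcard hpos]
  calc Real.exp (-(2 * M)) * ∑ w, Real.exp (f w)
      ≤ Real.exp (-(2 * M)) * (Fintype.card V * Real.exp M) := by gcongr
    _ = Real.exp (-M) * Fintype.card V := by
      rw [mul_left_comm, ← Real.exp_add, mul_comm]; ring_nf
    _ ≤ Real.exp (f v) * Fintype.card V := by
      gcongr; exact (abs_le.1 (hf v)).1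

/-- Let `p` be the softmax sequence model of uniformly bounded logits `a` (`|a s v| ≤ M`),
and let `q` be any sequence model whose per-step `eos` probability dominates that of `p`.
Then `NT_q(t) ≤ (1 - exp(-2M)/|V|)^t → 0`: any decoding algorithm whose induced `eos`
probability dominates the model's is consistent with respect to the model. -/
theorem stmt_11 {V : Type*} [Fintype V] [DecidableEq V] [Nonempty V] (eos : V)
    (M : ℝ) (hM : 0 ≤ M)
    (a : List V → V → ℝ) (ha : ∀ s v, |a s v| ≤ M)
    (p : List V → V → ℝ)
    (hp : ∀ s v, p s v = Real.exp (a s v) / ∑ w, Real.exp (a s w))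
    (q : List V → V → ℝ)
    (hq0 : ∀ s v, 0 ≤ q s v) (hq1 : ∀ s : List V, ∑ v, q s v = 1)
    (hdom : ∀ s : List V, p s eos ≤ q s eos) :
    (∀ t : ℕ, NT q eos t ≤ (1 - Real.exp (-(2 * M)) / (Fintype.card V : ℝ)) ^ t) ∧
      Tendsto (fun t => NT q eos t) atTop (nhds 0) := by
  set c := Real.exp (-(2 * M)) / (Fintype.card V : ℝ)
  have hc0 : 0 < c := div_pos (Real.exp_pos _) (Nat.cast_pos.2 Fintype.card_pos)
  have hcq (s : List V) : c ≤ q s eos :=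
    (exp_neg_div_card_le_softmax (ha s) eos).trans (hp s eos ▸ hdom s)
  have hsplit (s : List V) : q s eos + ∑ v ∈ Finset.univ.erase eos, q s v = 1 :=
    (Finset.add_sum_erase _ _ (Finset.mem_univ eos)).trans (hq1 s)
  have hsum (s : List V) : ∑ v ∈ Finset.univ.erase eos, q s v ≤ 1 - c := by
    linarith [hcq s, hsplit s]
  have hr : 0 ≤ 1 - c := (Finset.sum_nonneg fun v _ => hq0 [] v).trans (hsum [])
  have hle (t : ℕ) : NT q eos t ≤ (1 - c) ^ t := NT_le_pow hr hq0 hsum t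
  exact ⟨hle, squeeze_zero (NT_nonneg hq0 eos) hle
    (tendsto_pow_atTop_nhds_zero_of_lt_one hr (by linarith))⟩
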